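/- Let U ⊆ ℝ^n be open and let f : U → ℝ be real analytic on U. Then there exist an open set Ω ⊆ ℂ^n that contains the image of U under the natural embedding ℝ^n → ℂ^n and is invariant under coordinatewise complex conjugation, and a holomorphic function F : Ω → ℂ, such that F(x) = f(x) for every x ∈ U and F(z̄) = conj(F(z)) for every z ∈ Ω (where z̄ denotes coordinatewise complex conjugation). -/

import Mathlib

open Metric

/-- The complexification of a real multilinear form on `ℝⁿ`, given by the same coefficients in the
standard basis. -/
noncomputable def ContinuousMultilinearMap.complexifyPi {n k : ℕ}
    (p : ContinuousMultilinearMap ℝ (fun _ : Fin k => Fin n → ℝ) ℝ) :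
    ContinuousMultilinearMap ℂ (fun _ : Fin k => Fin n → ℂ) ℂ :=
  ∑ j : Fin k → Fin n, (p (fun i => Pi.single (j i) 1) : ℂ) •
    (ContinuousMultilinearMap.mkPiAlgebra ℂ (Fin k) ℂ).compContinuousLinearMap
      (fun i => ContinuousLinearMap.proj (j i))

namespace ContinuousMultilinearMap

variable {n k : ℕ} (p : ContinuousMultilinearMap ℝ (fun _ : Fin k => Fin n → ℝ) ℝ)

theorem complexifyPi_apply (v : Fin k → Fin n → ℂ) :
    p.complexifyPi v =
      ∑ j : Fin k → Fin n, (p (fun i => Pi.single (j i) 1) : ℂ) * ∏ i, v i (j i) := by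
  simp [complexifyPi]

theorem complexifyPi_ofReal (v : Fin k → Fin n → ℝ) :
    p.complexifyPi (fun i l => (v i l : ℂ)) = (p v : ℂ) := by
  have hv : v = fun i => ∑ l, v i l • (Pi.single l 1 : Fin n → ℝ) := by
    funext i
    exact pi_eq_sum_univ' (v i)
  have h : p v = ∑ j : Fin k → Fin n, p (fun i => Pi.single (j i) 1) * ∏ i, v i (j i) := by
    conv_lhs => rw [hv]
    rw [p.map_sum]
    refine Finset.sum_congr rfl fun j _ => ?_
    rw [p.map_smul_univ (fun i => v i (j i)) (fun i => Pi.single (j i) 1), smul_eq_mul, mul_comm]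
  rw [complexifyPi_apply, h]
  push_cast
  rfl

theorem complexifyPi_conj (v : Fin k → Fin n → ℂ) :
    p.complexifyPi (fun i l => (starRingEnd ℂ) (v i l)) = (starRingEnd ℂ) (p.complexifyPi v) := by
  simp [complexifyPi_apply, map_prod]

theorem norm_complexifyPi_le : ‖p.complexifyPi‖ ≤ ‖p‖ * (n : ℝ) ^ k := by
  refine ContinuousMultilinearMap.opNorm_le_bound (by positivity) fun v => ?_
  rw [complexifyPi_apply]
  calc ‖∑ j : Fin k → Fin n, (p (fun i => Pi.single (j i) 1) : ℂ) * ∏ i, v i (j i)‖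
      ≤ ∑ _j : Fin k → Fin n, ‖p‖ * ∏ i, ‖v i‖ := by
        refine norm_sum_le_of_le _ fun j _ => ?_
        rw [norm_mul, norm_prod, Complex.norm_real]
        have h1 : ‖p (fun i => Pi.single (j i) 1)‖ ≤ ‖p‖ := by
          refine p.unit_le_opNorm ?_
          refine (pi_norm_le_iff_of_nonneg zero_le_one).2 fun i => ?_
          simp [Pi.norm_single]
        exact mul_le_mul h1 (Finset.prod_le_prod (fun _ _ => norm_nonneg _)
          fun i _ => norm_le_pi_norm (v i) (j i)) (by positivity) (by positivity)
    _ = ‖p‖ * (n : ℝ) ^ k * ∏ i, ‖v i‖ := by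
        simp
        ring

end ContinuousMultilinearMap

theorem FormalMultilinearSeries.radius_complexifyPi_pos {n : ℕ}
    (p : FormalMultilinearSeries ℝ (Fin n → ℝ) ℝ) (hp : 0 < p.radius) :
    0 < FormalMultilinearSeries.radius (𝕜 := ℂ) (E := Fin n → ℂ) (F := ℂ)
      fun k => (p k).complexifyPi := by
  obtain ⟨r, hr0, hr⟩ := ENNReal.lt_iff_exists_nnreal_btwn.1 hp
  obtain ⟨C, -, hC⟩ := p.norm_mul_pow_le_of_lt_radius hr
  have hr0' : 0 < r := by exact_mod_cast hr0
  have hs : 0 < r / ((n : NNReal) + 1) := by positivity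
  refine lt_of_lt_of_le (by exact_mod_cast hs)
    (FormalMultilinearSeries.le_radius_of_bound _ C (r := r / ((n : NNReal) + 1)) fun k => ?_)
  calc ‖(p k).complexifyPi‖ * ((r / ((n : NNReal) + 1) : NNReal) : ℝ) ^ k
      ≤ ‖p k‖ * (n : ℝ) ^ k * ((r / ((n : NNReal) + 1) : NNReal) : ℝ) ^ k := by
        gcongr
        exact (p k).norm_complexifyPi_le
    _ = ‖p k‖ * ((n : ℝ) * (r / ((n : ℝ) + 1))) ^ k := by
        push_cast
        rw [mul_pow, mul_assoc]
    _ ≤ ‖p k‖ * (r : ℝ) ^ k := by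
        gcongr
        rw [mul_div_assoc', div_le_iff₀ (by positivity)]
        nlinarith [r.coe_nonneg]
    _ ≤ C := hC k

theorem dist_ofReal_pi {n : ℕ} (x y : Fin n → ℝ) :
    dist (fun i => (x i : ℂ)) (fun i => (y i : ℂ)) = dist x y := by
  simp only [dist_pi_def, nndist_eq_nnnorm, ← Complex.ofReal_sub, Complex.nnnorm_real]

theorem dist_conj_pi_ofReal {n : ℕ} (z : Fin n → ℂ) (x : Fin n → ℝ) :
    dist (fun i => (starRingEnd ℂ) (z i)) (fun i => (x i : ℂ)) = dist z (fun i => (x i : ℂ)) := by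
  have h (i : Fin n) : nndist ((starRingEnd ℂ) (z i)) (x i : ℂ) = nndist (z i) (x i : ℂ) := by
    simpa using Complex.nndist_conj_conj (z i) (x i : ℂ)
  simp only [dist_pi_def, h]

theorem dist_re_pi_le {n : ℕ} (z : Fin n → ℂ) (x : Fin n → ℝ) :
    dist (fun i => (z i).re) x ≤ dist z (fun i => (x i : ℂ)) := by
  refine (dist_pi_le_iff dist_nonneg).2 fun i => le_trans ?_ (dist_le_pi_dist z _ i)
  rw [Real.dist_eq, Complex.dist_eq]
  simpa using Complex.abs_re_le_norm (z i - x i)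

/-- A real analytic function extends, on some ball around each point, to a holomorphic function
commuting with complex conjugation. -/
theorem AnalyticAt.exists_conj_equivariant_extension_ball {n : ℕ} {f : (Fin n → ℝ) → ℝ}
    {x : Fin n → ℝ} (hf : AnalyticAt ℝ f x) :
    ∃ r : ℝ, 0 < r ∧ ∃ G : (Fin n → ℂ) → ℂ,
      AnalyticOnNhd ℂ G (ball (fun i => (x i : ℂ)) r) ∧
      (∀ y ∈ ball x r, G (fun i => (y i : ℂ)) = (f y : ℂ)) ∧
      ∀ z, G (fun i => (starRingEnd ℂ) (z i)) = (starRingEnd ℂ) (G z) := by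
  obtain ⟨p, s, hp⟩ := hf
  let q : FormalMultilinearSeries ℂ (Fin n → ℂ) ℂ := fun k => (p k).complexifyPi
  have hq : 0 < q.radius := p.radius_complexifyPi_pos (hp.r_pos.trans_le hp.r_le)
  obtain ⟨r, hr0, hr⟩ := ENNReal.lt_iff_exists_nnreal_btwn.1 (lt_min hp.r_pos hq)
  refine ⟨r, by exact_mod_cast hr0, fun z => q.sum (z - fun i => (x i : ℂ)), ?_, ?_, ?_⟩
  · intro z hz
    have h0 : AnalyticAt ℂ q.sum (z - fun i => (x i : ℂ)) := by
      refine (q.hasFPowerSeriesOnBall hq).analyticOnNhd _ ?_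
      refine Metric.eball_subset_eball (hr.le.trans (min_le_right _ _)) ?_
      rw [Metric.eball_coe]
      simpa [dist_eq_norm] using hz
    exact AnalyticAt.fun_comp (f := fun z => z - fun i => (x i : ℂ)) h0
      (analyticAt_id.sub analyticAt_const)
  · intro y hy
    have hy' : y - x ∈ Metric.eball (0 : Fin n → ℝ) s := by
      refine Metric.eball_subset_eball (hr.le.trans (min_le_left _ _)) ?_
      rw [Metric.eball_coe]
      simpa [dist_eq_norm] using hy
    have h := (hp.hasSum hy').tsum_eq
    rw [add_sub_cancel] at h
    rw [← h, Complex.ofReal_tsum]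
    refine tsum_congr fun k => ?_
    rw [← ContinuousMultilinearMap.complexifyPi_ofReal]
    congr 1
    funext i l
    simp
  · intro z
    change ∑' k, _ = (starRingEnd ℂ) (∑' k, _)
    rw [Complex.conj_tsum]
    refine tsum_congr fun k => ?_
    rw [← ContinuousMultilinearMap.complexifyPi_conj]
    congr 1
    funext i l
    simp

/-- Two holomorphic functions on a convex open set containing the real part of each of its points
coincide if they coincide at its real points. -/
theorem AnalyticOnNhd.eqOn_of_convex_of_eq_ofReal {n : ℕ} {W : Set (Fin n → ℂ)} (hWo : IsOpen W)
    (hWc : Convex ℝ W) (hWr : ∀ z ∈ W, (fun i => ((z i).re : ℂ)) ∈ W) {G H : (Fin n → ℂ) → ℂ}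
    (hG : AnalyticOnNhd ℂ G W) (hH : AnalyticOnNhd ℂ H W)
    (hGH : ∀ y : Fin n → ℝ, (fun i => (y i : ℂ)) ∈ W →
      G (fun i => (y i : ℂ)) = H (fun i => (y i : ℂ))) : Set.EqOn G H W := by
  intro z hz
  let φ : ℂ → Fin n → ℂ := fun t i => ((z i).re : ℂ) + t * ((z i).im : ℂ)
  have hφ (t : ℂ) : AnalyticAt ℂ φ t := by
    rw [analyticAt_pi_iff]
    intro i
    fun_prop
  have hφc : Continuous φ := continuous_iff_continuousAt.2 fun t => (hφ t).continuousAt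
  have hφI : φ Complex.I = z := by
    funext i
    simp [φ, mul_comm Complex.I, Complex.re_add_im]
  have hV0 : (0 : ℂ) ∈ φ ⁻¹' W := by simpa [φ] using hWr z hz
  have hVI : Complex.I ∈ φ ⁻¹' W := by
    rw [Set.mem_preimage, hφI]
    exact hz
  have hVc : Convex ℝ (φ ⁻¹' W) := by
    intro t ht u hu a b ha hb hab
    have h : φ (a • t + b • u) = a • φ t + b • φ u := by
      have hab' : (a : ℂ) + b = 1 := by exact_mod_cast hab
      funext i
      simp only [φ, Pi.add_apply, Pi.smul_apply, Complex.real_smul]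
      linear_combination (-((z i).re : ℂ)) * hab'
    rw [Set.mem_preimage, h]
    exact hWc ht hu ha hb hab
  have hreal : ∀ᶠ t : ℝ in nhds 0, G (φ t) = H (φ t) := by
    have hnhds : ∀ᶠ t : ℝ in nhds 0, φ t ∈ W :=
      (hφc.comp Complex.continuous_ofReal).continuousAt.eventually_mem
        (hWo.mem_nhds (by simpa using hV0))
    filter_upwards [hnhds] with t ht
    have h : φ t = fun i => (((z i).re + t * (z i).im : ℝ) : ℂ) := by
      funext i
      simp [φ]
    rw [h] at ht ⊢
    exact hGH _ ht
  have hfreq : ∃ᶠ t in nhdsWithin (0 : ℂ) {0}ᶜ, (G ∘ φ) t = (H ∘ φ) t := by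
    have hmap : Filter.Tendsto Complex.ofReal (nhdsWithin 0 {0}ᶜ) (nhdsWithin (0 : ℂ) {0}ᶜ) := by
      refine tendsto_nhdsWithin_iff.2 ⟨?_, ?_⟩
      · exact (Complex.continuous_ofReal.tendsto' 0 0 (by simp)).mono_left nhdsWithin_le_nhds
      · filter_upwards [self_mem_nhdsWithin] with t ht
        simpa using ht
    exact hmap.frequently (hreal.filter_mono nhdsWithin_le_nhds).frequently
  have heq := AnalyticOnNhd.eqOn_of_preconnected_of_frequently_eq
    (f := G ∘ φ) (g := H ∘ φ) (fun t ht => (hG _ ht).comp (hφ t))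
    (fun t ht => (hH _ ht).comp (hφ t)) hVc.isPreconnected hV0 hfreq hVI
  simpa [hφI] using heq


/-- Conjugation-equivariant holomorphic extension: every real analytic function `f` on an
open set `U ⊆ ℝⁿ` extends to a holomorphic function `F` on an open neighbourhood
`Ω ⊆ ℂⁿ` of (the image of) `U` which is invariant under coordinatewise complex
conjugation, with `F` equivariant with respect to conjugation: `F z̄ = conj (F z)`. -/
theorem exists_conj_equivariant_holomorphic_extension
    {n : ℕ} (U : Set (Fin n → ℝ)) (hU : IsOpen U) (f : (Fin n → ℝ) → ℝ)
    (hf : AnalyticOnNhd ℝ f U) :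
    ∃ Ω : Set (Fin n → ℂ), IsOpen Ω ∧
      ((fun x : Fin n → ℝ => fun i => (x i : ℂ)) '' U ⊆ Ω) ∧
      (∀ z ∈ Ω, (fun i => (starRingEnd ℂ) (z i)) ∈ Ω) ∧
      ∃ F : (Fin n → ℂ) → ℂ, AnalyticOnNhd ℂ F Ω ∧
        (∀ x ∈ U, F (fun i => (x i : ℂ)) = (f x : ℂ)) ∧
        ∀ z ∈ Ω, F (fun i => (starRingEnd ℂ) (z i)) = (starRingEnd ℂ) (F z) := by
  choose! r hr0 G hGan hGf hGconj using fun x (hx : x ∈ U) =>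
    (hf x hx).exists_conj_equivariant_extension_ball
  have hcompat {x x' : Fin n → ℝ} (hx : x ∈ U) (hx' : x' ∈ U) :
      Set.EqOn (G x) (G x')
        (ball (fun i => (x i : ℂ)) (r x) ∩ ball (fun i => (x' i : ℂ)) (r x')) := by
    refine AnalyticOnNhd.eqOn_of_convex_of_eq_ofReal (isOpen_ball.inter isOpen_ball)
      ((convex_ball _ _).inter (convex_ball _ _)) ?_
      ((hGan x hx).mono Set.inter_subset_left) ((hGan x' hx').mono Set.inter_subset_right) ?_
    · rintro z ⟨hz, hz'⟩
      simp only [Set.mem_inter_iff, mem_ball] at hz hz' ⊢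
      rw [dist_ofReal_pi (fun i => (z i).re), dist_ofReal_pi (fun i => (z i).re)]
      exact ⟨(dist_re_pi_le z x).trans_lt hz, (dist_re_pi_le z x').trans_lt hz'⟩
    · rintro y ⟨hy, hy'⟩
      rw [mem_ball, dist_ofReal_pi] at hy hy'
      rw [hGf x hx y hy, hGf x' hx' y hy']
  let Ω : Set (Fin n → ℂ) := ⋃ x ∈ U, ball (fun i => (x i : ℂ)) (r x)
  have hΩ {z : Fin n → ℂ} : z ∈ Ω ↔ ∃ x ∈ U, z ∈ ball (fun i => (x i : ℂ)) (r x) := by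
    simp only [Ω, Set.mem_iUnion₂, exists_prop]
  choose! c hcU hc using fun z (hz : z ∈ Ω) => hΩ.1 hz
  have hF {x : Fin n → ℝ} (hx : x ∈ U) :
      Set.EqOn (fun z => G (c z) z) (G x) (ball (fun i => (x i : ℂ)) (r x)) := fun z hz =>
    have hzΩ := hΩ.2 ⟨x, hx, hz⟩
    hcompat (hcU z hzΩ) hx ⟨hc z hzΩ, hz⟩
  have hconj {z : Fin n → ℂ} {x : Fin n → ℝ} (hz : z ∈ ball (fun i => (x i : ℂ)) (r x)) :
      (fun i => (starRingEnd ℂ) (z i)) ∈ ball (fun i => (x i : ℂ)) (r x) := by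
    rwa [mem_ball, dist_conj_pi_ofReal]
  refine ⟨Ω, isOpen_biUnion fun x _ => isOpen_ball, ?_, ?_, fun z => G (c z) z, ?_, ?_, ?_⟩
  · rintro _ ⟨x, hx, rfl⟩
    exact hΩ.2 ⟨x, hx, mem_ball_self (hr0 x hx)⟩
  · intro z hz
    exact hΩ.2 ⟨c z, hcU z hz, hconj (hc z hz)⟩
  · intro z hz
    obtain ⟨x, hx, hzx⟩ := hΩ.1 hz
    exact (hGan x hx z hzx).congr ((hF hx).symm.eventuallyEq_of_mem (isOpen_ball.mem_nhds hzx))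
  · intro x hx
    exact (hF hx (mem_ball_self (hr0 x hx))).trans (hGf x hx x (mem_ball_self (hr0 x hx)))
  · intro z hz
    exact (hF (hcU z hz) (hconj (hc z hz))).trans (hGconj _ (hcU z hz) z)
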